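/- Let X = ℝ and define h₁(x) = −|x−1|+2, h₂(x) = −|x+1|+2, h₃(x) = −|x|+2, h₄(x) = 0. Let H = {h₁,h₂,h₃,h₄}, A = {h₁,h₂} and B = {h₃,h₄}. Then: (i) A is the H-support set of f_A = max(h₁,h₂), so A is an (H,ℝ)-convex set; (ii) B is the H-support set of f_B = max(h₃,h₄), so B is an (H,ℝ)-convex set; (iii) A ∩ B = ∅; (iv) there is no point x ∈ ℝ such that b(x) > a(x) for every a ∈ A and every b ∈ B; and (v) there is no point x ∈ ℝ such that a(x) > b(x) for every a ∈ A and every b ∈ B. Hence two disjoint H-convex sets cannot in general be separated. -/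

import Mathlib

/-- Counterexample to separation of two disjoint abstract convex sets. -/
theorem statement0 :
    let h₁ : ℝ → ℝ := fun x => -|x - 1| + 2
    let h₂ : ℝ → ℝ := fun x => -|x + 1| + 2
    let h₃ : ℝ → ℝ := fun x => -|x| + 2
    let h₄ : ℝ → ℝ := fun _ => 0
    let H : Set (ℝ → ℝ) := {h₁, h₂, h₃, h₄}
    let A : Set (ℝ → ℝ) := {h₁, h₂}
    let B : Set (ℝ → ℝ) := {h₃, h₄}
    let fA : ℝ → ℝ := fun x => max (h₁ x) (h₂ x)
    let fB : ℝ → ℝ := fun x => max (h₃ x) (h₄ x)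
    -- (i) A is the H-support set of fA (A is (H,ℝ)-convex)
    A = {u ∈ H | ∀ y, u y ≤ fA y} ∧
    -- (ii) B is the H-support set of fB (B is (H,ℝ)-convex)
    B = {u ∈ H | ∀ y, u y ≤ fB y} ∧
    -- (iii) A and B are disjoint
    A ∩ B = ∅ ∧
    -- (iv) no point of ℝ puts all of B strictly above all of A
    (¬ ∃ x : ℝ, ∀ a ∈ A, ∀ b ∈ B, a x < b x) ∧
    -- (v) no point of ℝ puts all of A strictly above all of B
    (¬ ∃ x : ℝ, ∀ a ∈ A, ∀ b ∈ B, b x < a x) := by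
  intro h₁ h₂ h₃ h₄ H A B fA fB
  have h31 : ¬ ∀ y, h₃ y ≤ fA y := fun h => by
    have := h 0
    norm_num [h₁, h₂, h₃, fA] at this
  have h41 : ¬ ∀ y, h₄ y ≤ fA y := fun h => by
    have := h 10
    norm_num [h₁, h₂, h₄, fA] at this
  have h13 : ¬ ∀ y, h₁ y ≤ fB y := fun h => by
    have := h 1
    norm_num [h₁, h₃, h₄, fB] at this
  have h23 : ¬ ∀ y, h₂ y ≤ fB y := fun h => by
    have := h (-1)
    norm_num [h₂, h₃, h₄, fB] at this
  have hA : A = {u ∈ H | ∀ y, u y ≤ fA y} := by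
    ext u
    constructor
    · rintro (rfl | rfl)
      · exact ⟨Or.inl rfl, fun y => le_max_left _ _⟩
      · exact ⟨Or.inr (Or.inl rfl), fun y => le_max_right _ _⟩
    · rintro ⟨rfl | rfl | rfl | rfl, hu⟩
      · exact Or.inl rfl
      · exact Or.inr rfl
      · exact absurd hu h31
      · exact absurd hu h41
  have hB : B = {u ∈ H | ∀ y, u y ≤ fB y} := by
    ext u
    constructor
    · rintro (rfl | rfl)
      · exact ⟨Or.inr (Or.inr (Or.inl rfl)), fun y => le_max_left _ _⟩
      · exact ⟨Or.inr (Or.inr (Or.inr rfl)), fun y => le_max_right _ _⟩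
    · rintro ⟨rfl | rfl | rfl | rfl, hu⟩
      · exact absurd hu h13
      · exact absurd hu h23
      · exact Or.inl rfl
      · exact Or.inr rfl
  refine ⟨hA, hB, ?_, ?_, ?_⟩
  · rw [Set.eq_empty_iff_forall_notMem]
    rintro u ⟨hu, rfl | rfl⟩
    · exact h31 (hA ▸ hu : _ ∈ {u ∈ H | ∀ y, u y ≤ fA y}).2
    · exact h41 (hA ▸ hu : _ ∈ {u ∈ H | ∀ y, u y ≤ fA y}).2
  · rintro ⟨x, hx⟩
    have h₁₃ : -|x - 1| + 2 < -|x| + 2 := hx h₁ (Or.inl rfl) h₃ (Or.inl rfl)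
    have h₂₃ : -|x + 1| + 2 < -|x| + 2 := hx h₂ (Or.inr rfl) h₃ (Or.inl rfl)
    have h₁₄ : -|x - 1| + 2 < 0 := hx h₁ (Or.inl rfl) h₄ (Or.inr rfl)
    clear * - h₁₃ h₂₃ h₁₄
    grind
  · rintro ⟨x, hx⟩
    have h₁₃ : -|x| + 2 < -|x - 1| + 2 := hx h₁ (Or.inl rfl) h₃ (Or.inl rfl)
    have h₂₃ : -|x| + 2 < -|x + 1| + 2 := hx h₂ (Or.inr rfl) h₃ (Or.inl rfl)
    clear * - h₁₃ h₂₃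
    grind
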